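/- If u ∈ H₀(ℝ) (i.e. u is locally absolutely continuous with u' ∈ L²(ℝ) and Q̃·u ∈ L²(ℝ)) satisfies the orthogonality condition ∫φ₀·u = 0, then the quadratic form of L̃ at u is non-negative: ∫(u')² − (2/3)·∫Q̃³·u² ≥ 0. -/

import Mathlib

open Real MeasureTheory Filter

noncomputable def Qs (x : ℝ) : ℝ := (3/2) * (1 / Real.cosh (x/2))^2
noncomputable def Hs (x : ℝ) : ℝ := Real.tanh (x/2)
noncomputable def alphaFn (x : ℝ) : ℝ := (1/3) * (Real.sinh x + x)
noncomputable def alphaInv : ℝ → ℝ := Function.invFun alphaFn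
noncomputable def Qt (x : ℝ) : ℝ := Qs (alphaInv x)
noncomputable def Ht (x : ℝ) : ℝ := Hs (alphaInv x)
noncomputable def Vpot (x : ℝ) : ℝ := 2 * (Qt x)^2 * (1 - Qt x)

lemma one_add_sq_half_le_cosh (y : ℝ) : 1 + y ^ 2 / 2 ≤ cosh y := by
  have h1 : cosh y = 1 + 2 * sinh (y / 2) ^ 2 := by
    have h2 := Real.cosh_two_mul (y / 2)
    have h3 := Real.cosh_sq (y / 2)
    rw [show 2 * (y / 2) = y by ring] at h2
    linarith
  have h4 : (y / 2) ^ 2 ≤ sinh (y / 2) ^ 2 := by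
    rw [sq_le_sq, Real.abs_sinh]
    exact Real.self_le_sinh_iff.2 (abs_nonneg _)
  rw [h1]
  nlinarith

lemma hasDerivAt_alphaFn (y : ℝ) : HasDerivAt alphaFn (1 / 3 * (cosh y + 1)) y :=
  ((Real.hasDerivAt_sinh y).add (hasDerivAt_id y)).const_mul _

lemma strictMono_alphaFn : StrictMono alphaFn := by
  intro a b hab
  have := Real.sinh_lt_sinh.2 hab
  unfold alphaFn
  linarith

lemma surjective_alphaFn : Function.Surjective alphaFn := by
  have hc : Continuous alphaFn :=
    continuous_iff_continuousAt.2 fun y => (hasDerivAt_alphaFn y).continuousAt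
  refine hc.surjective ?_ ?_
  · refine tendsto_atTop_mono' atTop ?_
      (tendsto_id.const_mul_atTop (by norm_num : (0 : ℝ) < 1 / 3))
    filter_upwards [eventually_ge_atTop 0] with y hy
    have := Real.self_le_sinh_iff.2 hy
    simp only [id, alphaFn]
    linarith
  · refine tendsto_atBot_mono' atBot ?_
      (tendsto_id.const_mul_atBot (by norm_num : (0 : ℝ) < 1 / 3))
    filter_upwards [eventually_le_atBot 0] with y hy
    have := Real.sinh_le_self_iff.2 hy
    simp only [id, alphaFn]
    linarith

lemma alphaFn_alphaInv (x : ℝ) : alphaFn (alphaInv x) = x :=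
  Function.rightInverse_invFun surjective_alphaFn x

lemma strictMono_alphaInv : StrictMono alphaInv := fun a b hab =>
  strictMono_alphaFn.lt_iff_lt.1 (by simpa only [alphaFn_alphaInv] using hab)

lemma alphaInv_alphaFn (y : ℝ) : alphaInv (alphaFn y) = y :=
  strictMono_alphaFn.injective (alphaFn_alphaInv _)

lemma continuous_alphaInv : Continuous alphaInv :=
  strictMono_alphaInv.monotone.continuous_of_surjective fun y => ⟨_, alphaInv_alphaFn y⟩

lemma alphaInv_neg (x : ℝ) : alphaInv (-x) = -alphaInv x := by
  apply strictMono_alphaFn.injective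
  have h := alphaFn_alphaInv x
  rw [alphaFn_alphaInv]
  simp only [alphaFn, Real.sinh_neg] at h ⊢
  linarith

lemma alphaInv_zero : alphaInv 0 = 0 := by
  have := alphaInv_neg 0
  rw [neg_zero] at this
  linarith

lemma Qt_eq_inv (x : ℝ) : Qt x = (1 / 3 * (cosh (alphaInv x) + 1))⁻¹ := by
  have h2 := Real.cosh_two_mul (alphaInv x / 2)
  have h3 := Real.cosh_sq (alphaInv x / 2)
  rw [show 2 * (alphaInv x / 2) = alphaInv x by ring] at h2
  have h4 : cosh (alphaInv x) + 1 = 2 * cosh (alphaInv x / 2) ^ 2 := by linarith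
  have := Real.cosh_pos (alphaInv x / 2)
  rw [h4, Qt, Qs]
  field_simp

lemma hasDerivAt_alphaInv (x : ℝ) : HasDerivAt alphaInv (Qt x) x := by
  rw [Qt_eq_inv]
  have := Real.cosh_pos (alphaInv x)
  exact (hasDerivAt_alphaFn _).of_local_left_inverse continuous_alphaInv.continuousAt
    (by positivity) (Eventually.of_forall alphaFn_alphaInv)

lemma Qt_eq (x : ℝ) : Qt x = 3 / 2 * (1 - Ht x ^ 2) := by
  have h3 := Real.cosh_sq (alphaInv x / 2)
  have := Real.cosh_pos (alphaInv x / 2)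
  rw [Qt, Qs, Ht, Hs, Real.tanh_eq_sinh_div_cosh]
  field_simp
  linarith

lemma hasDerivAt_Ht (x : ℝ) : HasDerivAt Ht (3 / 4 * (1 - Ht x ^ 2) ^ 2) x := by
  have h1 : HasDerivAt (fun x => alphaInv x / 2) (Qt x / 2) x := (hasDerivAt_alphaInv x).div_const 2
  have hne := (Real.cosh_pos (alphaInv x / 2)).ne'
  have h2 := (h1.sinh.div h1.cosh hne)
  have h3 : Ht = (fun x => sinh (alphaInv x / 2)) / fun x => cosh (alphaInv x / 2) := by
    ext x
    simp [Ht, Hs, Real.tanh_eq_sinh_div_cosh]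
  have h4 : 3 / 4 * (1 - Ht x ^ 2) ^ 2 = (cosh (alphaInv x / 2) * (Qt x / 2) *
      cosh (alphaInv x / 2) - sinh (alphaInv x / 2) * (sinh (alphaInv x / 2) * (Qt x / 2))) /
      cosh (alphaInv x / 2) ^ 2 := by
    rw [Qt_eq, Ht, Hs, Real.tanh_eq_sinh_div_cosh]
    field_simp
    ring
  rw [h4, h3]
  exact h2

lemma Ht_neg (x : ℝ) : Ht (-x) = -Ht x := by
  simp [Ht, Hs, alphaInv_neg, neg_div, Real.tanh_neg]

lemma Qt_neg (x : ℝ) : Qt (-x) = Qt x := by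
  rw [Qt_eq, Qt_eq, Ht_neg, neg_sq]

lemma Ht_zero : Ht 0 = 0 := by
  simp [Ht, Hs, alphaInv_zero]

lemma Ht_lt_one (x : ℝ) : Ht x < 1 := Real.tanh_lt_one _

lemma Ht_sq_lt_one (x : ℝ) : Ht x ^ 2 < 1 := Real.tanh_sq_lt_one _

lemma Qt_pos (x : ℝ) : 0 < Qt x := by
  rw [Qt_eq]
  linarith [Ht_sq_lt_one x]

lemma Qt_le (x : ℝ) : Qt x ≤ 3 / 2 := by
  rw [Qt_eq]
  nlinarith [sq_nonneg (Ht x)]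

lemma differentiable_Ht : Differentiable ℝ Ht := fun x => (hasDerivAt_Ht x).differentiableAt

lemma continuous_Ht : Continuous Ht := differentiable_Ht.continuous

lemma continuous_Qt : Continuous Qt := by
  have : Qt = fun x => 3 / 2 * (1 - Ht x ^ 2) := funext Qt_eq
  rw [this]
  have := continuous_Ht
  fun_prop

lemma contDiff_Ht : ContDiff ℝ 1 Ht := by
  rw [contDiff_one_iff_deriv]
  refine ⟨differentiable_Ht, ?_⟩
  rw [show deriv Ht = fun x => 3 / 4 * (1 - Ht x ^ 2) ^ 2 from
    funext fun x => (hasDerivAt_Ht x).deriv]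
  have := continuous_Ht
  fun_prop

lemma contDiff_alphaInv : ContDiff ℝ 1 alphaInv := by
  rw [contDiff_one_iff_deriv]
  refine ⟨fun x => (hasDerivAt_alphaInv x).differentiableAt, ?_⟩
  rw [show deriv alphaInv = Qt from funext fun x => (hasDerivAt_alphaInv x).deriv]
  exact continuous_Qt

lemma strictMono_Ht : StrictMono Ht := by
  refine strictMono_of_deriv_pos fun x => ?_
  rw [(hasDerivAt_Ht x).deriv]
  have := Ht_sq_lt_one x
  have : 0 < 1 - Ht x ^ 2 := by linarith
  positivity

lemma Ht_pos {x : ℝ} (hx : 0 < x) : 0 < Ht x := Ht_zero ▸ strictMono_Ht hx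

lemma Ht_nonneg {x : ℝ} (hx : 0 ≤ x) : 0 ≤ Ht x := Ht_zero ▸ strictMono_Ht.monotone hx

/-- The function `x + (2/3) α⁻¹(x)`, whose derivative is `2 - H̃²`. -/
noncomputable def Jt (x : ℝ) : ℝ := x + 2 / 3 * alphaInv x

/-- The even solution of `L̃ K = 0`. -/
noncomputable def Kt (x : ℝ) : ℝ := 1 - 3 / 4 * Ht x * Jt x

lemma hasDerivAt_Jt (x : ℝ) : HasDerivAt Jt (2 - Ht x ^ 2) x := by
  have := (hasDerivAt_id x).add ((hasDerivAt_alphaInv x).const_mul (2 / 3))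
  rw [Qt_eq] at this
  exact this.congr_deriv (by ring)

lemma Jt_zero : Jt 0 = 0 := by
  simp [Jt, alphaInv_zero]

lemma continuous_Jt : Continuous Jt :=
  continuous_iff_continuousAt.2 fun x => (hasDerivAt_Jt x).continuousAt

lemma continuous_Kt : Continuous Kt := by
  have := continuous_Ht
  have := continuous_Jt
  unfold Kt
  fun_prop

lemma contDiff_Kt : ContDiff ℝ 1 Kt := by
  have := contDiff_Ht
  have := contDiff_alphaInv
  unfold Kt Jt
  fun_prop

lemma monotone_Jt : Monotone Jt := by
  refine monotone_of_deriv_nonneg (fun x => (hasDerivAt_Jt x).differentiableAt) fun x => ?_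
  rw [(hasDerivAt_Jt x).deriv]
  linarith [Ht_sq_lt_one x]

lemma Jt_nonneg {x : ℝ} (hx : 0 ≤ x) : 0 ≤ Jt x := Jt_zero ▸ monotone_Jt hx

lemma Jt_le {x : ℝ} (hx : 0 ≤ x) : Jt x ≤ 2 * x := by
  have hm : Monotone fun x => 2 * x - Jt x := by
    have hd (x : ℝ) := ((hasDerivAt_id x).const_mul 2).sub (hasDerivAt_Jt x)
    refine monotone_of_deriv_nonneg (fun x => (hd x).differentiableAt) fun x => ?_
    refine ((hd x).deriv).symm ▸ ?_
    nlinarith [sq_nonneg (Ht x)]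
  have := hm hx
  simp only [Jt_zero] at this
  linarith

lemma Ht_le {x : ℝ} (hx : 0 ≤ x) : Ht x ≤ 3 / 4 * x := by
  have hm : Monotone fun x => 3 / 4 * x - Ht x := by
    have hd (x : ℝ) := ((hasDerivAt_id x).const_mul (3 / 4)).sub (hasDerivAt_Ht x)
    refine monotone_of_deriv_nonneg (fun x => (hd x).differentiableAt) fun x => ?_
    refine ((hd x).deriv).symm ▸ ?_
    nlinarith [sq_nonneg (Ht x), Ht_sq_lt_one x]
  have := hm hx
  simp only [Ht_zero] at this
  linarith

lemma Kt_le_one {x : ℝ} (hx : 0 ≤ x) : Kt x ≤ 1 := by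
  have := mul_nonneg (Ht_nonneg hx) (Jt_nonneg hx)
  unfold Kt
  linarith

lemma Kt_ge {x : ℝ} (hx : 0 ≤ x) : 1 - 9 / 8 * x ^ 2 ≤ Kt x := by
  have := mul_le_mul (Ht_le hx) (Jt_le hx) (Jt_nonneg hx) (by positivity)
  unfold Kt
  linarith

lemma Kt_ge_linear {x : ℝ} (hx : 0 ≤ x) : 1 - 3 / 2 * x ≤ Kt x := by
  have := mul_le_mul (Ht_lt_one x).le (Jt_le hx) (Jt_nonneg hx) zero_le_one
  unfold Kt
  linarith

lemma two_le_cosh_alphaInv {x : ℝ} (hx : 1.05 ≤ x) : 2 ≤ cosh (alphaInv x) := by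
  by_contra! hlt
  have h1 := one_add_sq_half_le_cosh (alphaInv x)
  have h2 := Real.cosh_sq (alphaInv x)
  have h3 := alphaFn_alphaInv x
  have h4 := Real.cosh_pos (alphaInv x)
  unfold alphaFn at h3
  have h5 : alphaInv x < 1.4143 := by nlinarith
  have h6 : sinh (alphaInv x) < 1.7321 := by nlinarith
  norm_num at hx h5 h6
  linarith

lemma Qt_le_one {x : ℝ} (hx : 1.05 ≤ x) : Qt x ≤ 1 := by
  rw [Qt_eq_inv]
  apply inv_le_one_of_one_le₀
  linarith [two_le_cosh_alphaInv hx]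

lemma Jt_ge {x : ℝ} (hx : 1.05 ≤ x) : 1.8 ≤ Jt x := by
  have h1 := two_le_cosh_alphaInv hx
  have h2 : 0 ≤ alphaInv x := by
    rw [← alphaInv_zero]
    exact strictMono_alphaInv.monotone (by norm_num at hx; linarith)
  have h3 : 1.125 ≤ alphaInv x := by
    by_contra! hlt
    have h4 := h1.trans (Real.cosh_le_exp_half_sq (alphaInv x))
    have h5 := (Real.log_le_iff_le_exp two_pos).2 h4
    have := Real.log_two_gt_d9
    norm_num at hlt this
    nlinarith
  unfold Jt
  norm_num at hx h3 ⊢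
  linarith

lemma Jt_split_le : Jt 1.05 ≤ 2.025 := by
  have h1 : alphaInv 1.05 ≤ 1.46 := by
    rw [← strictMono_alphaFn.le_iff_le, alphaFn_alphaInv, alphaFn]
    have h2 := Real.sinh_two_mul (1.46 / 2)
    have h3 : (1.46 / 2 : ℝ) ≤ sinh (1.46 / 2) := Real.self_le_sinh_iff.2 (by norm_num)
    have h4 := one_add_sq_half_le_cosh (1.46 / 2)
    have h5 := mul_le_mul h3 h4 (by positivity) (by linarith)
    norm_num at h2 h5 ⊢
    linarith
  unfold Jt
  norm_num at h1 ⊢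
  linarith

lemma integrable_exp_neg_mul_abs {c : ℝ} (hc : 0 < c) :
    Integrable fun x : ℝ => exp (-c * |x|) := by
  rw [← integrableOn_univ, ← Set.Iic_union_Ioi (a := (0 : ℝ))]
  refine IntegrableOn.union ?_ ?_
  · refine (integrableOn_exp_mul_Iic hc 0).congr_fun (fun x hx => ?_) measurableSet_Iic
    simp only [abs_of_nonpos (Set.mem_Iic.1 hx), neg_mul_neg]
  · refine (integrableOn_exp_mul_Ioi (neg_lt_zero.2 hc) 0).congr_fun (fun x hx => ?_)
      measurableSet_Ioi
    simp only [abs_of_pos (Set.mem_Ioi.1 hx)]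

lemma one_add_mul_exp_neg_le {c x : ℝ} (hc : 0 < c) (hx : 0 ≤ x) :
    (1 + x) * exp (-c * x) ≤ (1 + 2 / c) * exp (-(c / 2) * x) := by
  have h1 : exp (-c * x) = exp (-(c / 2) * x) * exp (-(c / 2) * x) := by
    rw [← Real.exp_add]
    ring_nf
  have h2 : exp (-(c / 2) * x) * exp (c / 2 * x) = 1 := by
    rw [← Real.exp_add]
    simp
  have h3 := Real.add_one_le_exp (c / 2 * x)
  have h4 : 0 ≤ 2 / c := by positivity
  have h5 : x = 2 / c * (c / 2 * x) := by field_simp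
  have h6 : 0 ≤ c / 2 * x := by positivity
  have h7 : 1 + x ≤ (1 + 2 / c) * exp (c / 2 * x) := by nlinarith
  calc (1 + x) * exp (-c * x)
      ≤ ((1 + 2 / c) * exp (c / 2 * x)) * exp (-c * x) := by gcongr
    _ = (1 + 2 / c) * (exp (-(c / 2) * x) * exp (c / 2 * x)) * exp (-(c / 2) * x) := by
        rw [h1]; ring
    _ = _ := by rw [h2, mul_one]

lemma tendsto_exp_neg_mul_atTop {c : ℝ} (hc : 0 < c) :
    Tendsto (fun x : ℝ => exp (-c * x)) atTop (nhds 0) :=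
  Real.tendsto_exp_atBot.comp (tendsto_id.const_mul_atTop_of_neg (neg_lt_zero.2 hc))

lemma nonpos_of_deriv_nonneg_of_tendsto_zero {f f' : ℝ → ℝ} {a : ℝ}
    (hf : ∀ x, HasDerivAt f (f' x) x) (hf' : ∀ x, a ≤ x → 0 ≤ f' x)
    (hlim : Tendsto f atTop (nhds 0)) : f a ≤ 0 := by
  have hm : MonotoneOn f (Set.Ici a) := by
    refine monotoneOn_of_deriv_nonneg (convex_Ici a)
      (fun x _ => (hf x).continuousAt.continuousWithinAt)
      (fun x _ => (hf x).differentiableAt.differentiableWithinAt) fun x hx => ?_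
    rw [(hf x).deriv]
    exact hf' x (interior_subset hx)
  refine ge_of_tendsto hlim ?_
  filter_upwards [eventually_ge_atTop a] with x hx
  exact hm Set.self_mem_Ici hx hx

/-- The properties of the ground state of `-∂² + V` that are used in the proof. -/
structure IsGroundState (φ : ℝ → ℝ) (μ : ℝ) : Prop where
  contDiff : ContDiff ℝ 2 φ
  pos : ∀ x, 0 < φ x
  even : ∀ x, φ (-x) = φ x
  le_mu : 0.808 ≤ μ
  deriv_deriv : ∀ x, deriv (deriv φ) x = (Vpot x + μ ^ 2) * φ x
  decay : ∃ C > 0, ∃ c > 0, ∀ x, |φ x| + |deriv φ x| ≤ C * exp (-c * |x|)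

/-- The tail integral `∫_x^∞ φ H̃`. -/
noncomputable def tailInt (φ : ℝ → ℝ) (x : ℝ) : ℝ :=
  (∫ t in Set.Ioi 0, φ t * Ht t) - ∫ t in 0..x, φ t * Ht t

lemma Vpot_add_nonneg_of_le {μ x t : ℝ} (hx : 0 ≤ x) (hxt : x ≤ t)
    (h : 0 ≤ Vpot x + μ ^ 2) : 0 ≤ Vpot t + μ ^ 2 := by
  have h1 : Qt t ≤ Qt x := by
    rw [Qt_eq, Qt_eq]
    nlinarith [strictMono_Ht.monotone hxt, Ht_nonneg hx]
  unfold Vpot at *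
  rcases le_total (Qt t) 1 with h2 | h2
  · have : 0 ≤ 1 - Qt t := by linarith
    positivity
  · have h3 : Qt t ^ 2 * (Qt t - 1) ≤ Qt x ^ 2 * (Qt x - 1) := by
      gcongr
    linarith

namespace IsGroundState

variable {φ : ℝ → ℝ} {μ : ℝ}

lemma hasDerivAt (hφ : IsGroundState φ μ) (x : ℝ) : HasDerivAt φ (deriv φ x) x :=
  (hφ.contDiff.differentiable (by norm_num) x).hasDerivAt

lemma hasDerivAt_deriv (hφ : IsGroundState φ μ) (x : ℝ) :
    HasDerivAt (deriv φ) ((Vpot x + μ ^ 2) * φ x) x := by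
  rw [← hφ.deriv_deriv]
  have h : ContDiff ℝ (1 + 1) φ := hφ.contDiff
  exact ((contDiff_succ_iff_deriv.1 h).2.2.differentiable (by norm_num) x).hasDerivAt

lemma continuous (hφ : IsGroundState φ μ) : Continuous φ := hφ.contDiff.continuous

lemma tendsto_zero (hφ : IsGroundState φ μ) :
    Tendsto φ atTop (nhds 0) ∧ Tendsto (deriv φ) atTop (nhds 0) := by
  obtain ⟨C, -, c, hc, h⟩ := hφ.decay
  have hlim : Tendsto (fun x : ℝ => C * exp (-c * x)) atTop (nhds 0) := by
    simpa using (tendsto_exp_neg_mul_atTop hc).const_mul C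
  have hle (x : ℝ) (hx : 0 ≤ x) := abs_of_nonneg hx ▸ h x
  constructor
  · refine squeeze_zero_norm' ?_ hlim
    filter_upwards [eventually_ge_atTop 0] with x hx
    rw [Real.norm_eq_abs]
    linarith [hle x hx, abs_nonneg (deriv φ x)]
  · refine squeeze_zero_norm' ?_ hlim
    filter_upwards [eventually_ge_atTop 0] with x hx
    rw [Real.norm_eq_abs]
    linarith [hle x hx, abs_nonneg (φ x)]

lemma integrable_mul_of_linear_growth (hφ : IsGroundState φ μ) {v : ℝ → ℝ}
    (hv : AEStronglyMeasurable v) {A : ℝ} (h : ∀ x, |v x| ≤ A * (1 + |x|)) :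
    Integrable fun x => φ x * v x := by
  obtain ⟨C, hC, c, hc, hdec⟩ := hφ.decay
  have hA : 0 ≤ A := by simpa using (abs_nonneg _).trans (h 0)
  refine ((integrable_exp_neg_mul_abs (half_pos hc)).const_mul (C * A * (1 + 2 / c))).mono'
    (hφ.continuous.aestronglyMeasurable.mul hv) (Eventually.of_forall fun x => ?_)
  have h1 : |φ x| ≤ C * exp (-c * |x|) := by linarith [hdec x, abs_nonneg (deriv φ x)]
  rw [Real.norm_eq_abs, abs_mul]
  calc |φ x| * |v x| ≤ (C * exp (-c * |x|)) * (A * (1 + |x|)) := by gcongr; exact h x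
    _ = C * A * ((1 + |x|) * exp (-c * |x|)) := by ring
    _ ≤ C * A * ((1 + 2 / c) * exp (-(c / 2) * |x|)) := by
        have := one_add_mul_exp_neg_le hc (abs_nonneg x)
        gcongr
    _ = _ := by ring

lemma integrable_mul_Ht (hφ : IsGroundState φ μ) : Integrable fun x => φ x * Ht x := by
  refine hφ.integrable_mul_of_linear_growth (A := 1) continuous_Ht.aestronglyMeasurable fun x => ?_
  have : |Ht x| < 1 := Real.abs_tanh_lt_one _
  linarith [abs_nonneg x]

lemma deriv_zero (hφ : IsGroundState φ μ) : deriv φ 0 = 0 := by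
  have h1 := hφ.hasDerivAt 0
  have h2 : HasDerivAt (fun x => φ (-x)) (-deriv φ 0) 0 := by
    have h3 : HasDerivAt φ (deriv φ 0) (-0) := by simpa using h1
    exact (h3.comp 0 (hasDerivAt_neg (0 : ℝ))).congr_deriv (by ring)
  rw [show (fun x => φ (-x)) = φ from funext hφ.even] at h2
  linarith [h1.unique h2]

lemma deriv_nonpos (hφ : IsGroundState φ μ) {x : ℝ} (hx : 0 ≤ x) : deriv φ x ≤ 0 := by
  rcases le_or_gt 0 (Vpot x + μ ^ 2) with h | h
  · exact nonpos_of_deriv_nonneg_of_tendsto_zero hφ.hasDerivAt_deriv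
      (fun t ht => mul_nonneg (Vpot_add_nonneg_of_le hx ht h) (hφ.pos t).le) hφ.tendsto_zero.2
  · have hneg (t : ℝ) (h0 : 0 ≤ t) (ht : t < x) : Vpot t + μ ^ 2 ≤ 0 := by
      by_contra! hlt
      exact absurd (Vpot_add_nonneg_of_le h0 ht.le hlt.le) (not_le.2 h)
    have ha : AntitoneOn (deriv φ) (Set.Icc 0 x) := by
      refine antitoneOn_of_deriv_nonpos (convex_Icc 0 x)
        (fun t _ => (hφ.hasDerivAt_deriv t).continuousAt.continuousWithinAt)
        (fun t _ => (hφ.hasDerivAt_deriv t).differentiableAt.differentiableWithinAt)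
        fun t ht => ?_
      rw [interior_Icc] at ht
      rw [(hφ.hasDerivAt_deriv t).deriv]
      exact mul_nonpos_of_nonpos_of_nonneg (hneg t ht.1.le ht.2) (hφ.pos t).le
    rw [← hφ.deriv_zero]
    exact ha (Set.left_mem_Icc.2 hx) (Set.right_mem_Icc.2 hx) hx

lemma deriv_le (hφ : IsGroundState φ μ) {x : ℝ} (hx : 1.05 ≤ x) :
    deriv φ x ≤ -0.808 * φ x := by
  have hd (t : ℝ) : HasDerivAt (fun t => (deriv φ t + 0.808 * φ t) * exp (-0.808 * t))
      ((Vpot t + (μ ^ 2 - 0.808 ^ 2)) * φ t * exp (-0.808 * t)) t := by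
    refine (((hφ.hasDerivAt_deriv t).add ((hφ.hasDerivAt t).const_mul 0.808)).mul
      (((hasDerivAt_id t).const_mul (-0.808)).exp)).congr_deriv ?_
    simp only [id, Pi.add_apply]
    ring
  have hV (t : ℝ) (ht : x ≤ t) : 0 ≤ (Vpot t + (μ ^ 2 - 0.808 ^ 2)) * φ t * exp (-0.808 * t) := by
    have h1 := Qt_le_one (hx.trans ht)
    have h2 : 0 ≤ Vpot t := by
      have : 0 ≤ 1 - Qt t := by linarith
      unfold Vpot
      positivity
    have h3 : 0 ≤ μ ^ 2 - 0.808 ^ 2 := by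
      have := hφ.le_mu
      nlinarith
    have := hφ.pos t
    positivity
  have hlim : Tendsto (fun t => (deriv φ t + 0.808 * φ t) * exp (-0.808 * t)) atTop (nhds 0) := by
    simpa using (hφ.tendsto_zero.2.add (hφ.tendsto_zero.1.const_mul 0.808)).mul
      (tendsto_exp_neg_mul_atTop (by norm_num : (0 : ℝ) < 0.808))
  have := nonpos_of_deriv_nonneg_of_tendsto_zero hd hV hlim
  have := nonpos_of_mul_nonpos_left this (Real.exp_pos _)
  linarith

lemma hasDerivAt_tailInt (hφ : IsGroundState φ μ) (x : ℝ) :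
    HasDerivAt (tailInt φ) (-(φ x * Ht x)) x := by
  have hc : Continuous fun t => φ t * Ht t := hφ.continuous.mul continuous_Ht
  exact (intervalIntegral.integral_hasDerivAt_right (hc.intervalIntegrable _ _)
    (hc.stronglyMeasurableAtFilter _ _) hc.continuousAt).const_sub _

lemma contDiff_tailInt (hφ : IsGroundState φ μ) : ContDiff ℝ 1 (tailInt φ) := by
  rw [contDiff_one_iff_deriv]
  refine ⟨fun x => (hφ.hasDerivAt_tailInt x).differentiableAt, ?_⟩
  rw [show deriv (tailInt φ) = fun x => -(φ x * Ht x) from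
    funext fun x => (hφ.hasDerivAt_tailInt x).deriv]
  exact (hφ.continuous.mul continuous_Ht).neg

lemma continuous_tailInt (hφ : IsGroundState φ μ) : Continuous (tailInt φ) :=
  hφ.contDiff_tailInt.continuous

lemma tendsto_tailInt (hφ : IsGroundState φ μ) : Tendsto (tailInt φ) atTop (nhds 0) := by
  have := (intervalIntegral_tendsto_integral_Ioi 0 hφ.integrable_mul_Ht.integrableOn
    tendsto_id).const_sub (∫ t in Set.Ioi 0, φ t * Ht t)
  rw [sub_self] at this
  exact this

lemma tailInt_nonneg (hφ : IsGroundState φ μ) {x : ℝ} (hx : 0 ≤ x) : 0 ≤ tailInt φ x := by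
  have := nonpos_of_deriv_nonneg_of_tendsto_zero (f := fun x => -tailInt φ x) (a := x)
    (fun t => (hφ.hasDerivAt_tailInt t).neg)
    (fun t ht => by
      rw [neg_neg]
      exact mul_nonneg (hφ.pos t).le (Ht_nonneg (hx.trans ht)))
    (by simpa using hφ.tendsto_tailInt.neg)
  linarith

lemma tailInt_antitoneOn (hφ : IsGroundState φ μ) : AntitoneOn (tailInt φ) (Set.Ici 0) := by
  refine antitoneOn_of_deriv_nonpos (convex_Ici 0) hφ.continuous_tailInt.continuousOn
    (fun x _ => (hφ.hasDerivAt_tailInt x).differentiableAt.differentiableWithinAt) fun x hx => ?_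
  rw [(hφ.hasDerivAt_tailInt x).deriv]
  exact neg_nonpos.2 (mul_nonneg (hφ.pos x).le (Ht_nonneg (interior_subset hx)))

lemma tailInt_zero_pos (hφ : IsGroundState φ μ) : 0 < tailInt φ 0 := by
  have h1 : 0 < ∫ t in (0 : ℝ)..1, φ t * Ht t :=
    intervalIntegral.intervalIntegral_pos_of_pos_on
      ((hφ.continuous.mul continuous_Ht).intervalIntegrable _ _)
      (fun x hx => mul_pos (hφ.pos x) (Ht_pos hx.1)) one_pos
  have h2 := hφ.tailInt_nonneg zero_le_one
  simp only [tailInt, intervalIntegral.integral_same, sub_zero] at h2 ⊢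
  linarith

lemma tailInt_le (hφ : IsGroundState φ μ) {x : ℝ} (hx : 1.05 ≤ x) :
    0.808 * tailInt φ x ≤ φ x := by
  have := nonpos_of_deriv_nonneg_of_tendsto_zero (f := fun x => 0.808 * tailInt φ x - φ x) (a := x)
    (fun t => ((hφ.hasDerivAt_tailInt t).const_mul 0.808).sub (hφ.hasDerivAt t))
    (fun t ht => by
      have h1 := hφ.deriv_le (hx.trans ht)
      have h2 := mul_nonneg (hφ.pos t).le (sub_nonneg.2 (Ht_lt_one t).le)
      linarith)
    (by simpa using (hφ.tendsto_tailInt.const_mul 0.808).sub hφ.tendsto_zero.1)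
  linarith

lemma tendsto_tailInt_mul_one_add (hφ : IsGroundState φ μ) :
    Tendsto (fun x => tailInt φ x * (1 + x)) atTop (nhds 0) := by
  obtain ⟨C, hC, c, hc, hdec⟩ := hφ.decay
  have hlim : Tendsto (fun x : ℝ => C / 0.808 * (1 + 2 / c) * exp (-(c / 2) * x))
      atTop (nhds 0) := by
    simpa using (tendsto_exp_neg_mul_atTop (half_pos hc)).const_mul (C / 0.808 * (1 + 2 / c))
  refine squeeze_zero' ?_ ?_ hlim
  · filter_upwards [eventually_ge_atTop 0] with x hx
    exact mul_nonneg (hφ.tailInt_nonneg hx) (by linarith)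
  · filter_upwards [eventually_ge_atTop 1.05] with x hx
    have hx0 : 0 ≤ x := le_trans (by norm_num) hx
    have h1 := hφ.tailInt_le hx
    have h2 := hdec x
    rw [abs_of_nonneg hx0, abs_of_pos (hφ.pos x)] at h2
    have h3 : tailInt φ x ≤ C / 0.808 * exp (-c * x) := by
      have := abs_nonneg (deriv φ x)
      rw [div_mul_eq_mul_div, le_div_iff₀ (by norm_num)]
      linarith
    calc tailInt φ x * (1 + x) ≤ (C / 0.808 * exp (-c * x)) * (1 + x) := by gcongr
      _ = C / 0.808 * ((1 + x) * exp (-c * x)) := by ring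
      _ ≤ C / 0.808 * ((1 + 2 / c) * exp (-(c / 2) * x)) := by
          gcongr C / 0.808 * ?_
          exact one_add_mul_exp_neg_le hc hx0
      _ = _ := by ring

lemma hasDerivAt_mul_tailInt (hφ : IsGroundState φ μ) (x : ℝ) :
    HasDerivAt (fun x => φ x * tailInt φ x)
      (deriv φ x * tailInt φ x - φ x ^ 2 * Ht x) x :=
  ((hφ.hasDerivAt x).mul (hφ.hasDerivAt_tailInt x)).congr_deriv (by ring)

/-- On the initial interval, `K` integrates to at least `x - (3/8) x³` against any decreasing
weight. -/
lemma le_integral_initial (hφ : IsGroundState φ μ) :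
    φ 1.05 * tailInt φ 1.05 * (1.05 - 3 / 8 * 1.05 ^ 3) ≤
      ∫ x in (0 : ℝ)..1.05, φ x * tailInt φ x * Kt x := by
  have hd (x : ℝ) : HasDerivAt (fun x => φ x * tailInt φ x * (x - 3 / 8 * x ^ 3))
      ((deriv φ x * tailInt φ x - φ x ^ 2 * Ht x) * (x - 3 / 8 * x ^ 3)
        + φ x * tailInt φ x * (1 - 9 / 8 * x ^ 2)) x := by
    refine ((hφ.hasDerivAt_mul_tailInt x).mul
      ((hasDerivAt_id x).sub (((hasDerivAt_id x).pow 3).const_mul (3 / 8)))).congr_deriv ?_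
    simp only [id, Pi.sub_apply, Pi.pow_apply]
    push_cast
    ring
  have := intervalIntegral.sub_le_integral_of_hasDeriv_right_of_le
    (g := fun x => φ x * tailInt φ x * (x - 3 / 8 * x ^ 3))
    (φ := fun x => φ x * tailInt φ x * Kt x) (by norm_num : (0 : ℝ) ≤ 1.05)
    (fun x _ => (hd x).continuousAt.continuousWithinAt)
    (fun x _ => (hd x).hasDerivWithinAt)
    (((hφ.continuous.mul hφ.continuous_tailInt).mul continuous_Kt).continuousOn.integrableOn_Icc)
    (fun x hx => by
      have h0 := hx.1.le
      have h1 : 0 ≤ x - 3 / 8 * x ^ 3 := by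
        have : x ^ 2 ≤ 1.05 ^ 2 := by gcongr; exact hx.2.le
        norm_num at this
        nlinarith
      have h2 : deriv φ x * tailInt φ x ≤ 0 :=
        mul_nonpos_of_nonpos_of_nonneg (hφ.deriv_nonpos h0) (hφ.tailInt_nonneg h0)
      have h3 : 0 ≤ φ x ^ 2 * Ht x := mul_nonneg (sq_nonneg _) (Ht_nonneg h0)
      have h4 := mul_nonpos_of_nonpos_of_nonneg (by linarith :
        deriv φ x * tailInt φ x - φ x ^ 2 * Ht x ≤ 0) h1
      have h5 := mul_le_mul_of_nonneg_left (Kt_ge h0)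
        (mul_nonneg (hφ.pos x).le (hφ.tailInt_nonneg h0))
      linarith)
  simpa using this

lemma le_integral_tail (hφ : IsGroundState φ μ) {X : ℝ} (hX : 1.05 ≤ X) :
    -(φ 1.05 * tailInt φ 1.05 * (0.466 * Jt 1.05 - 0.33)) ≤
      ∫ x in (1.05 : ℝ)..X, φ x * tailInt φ x * Kt x := by
  have hd (x : ℝ) : HasDerivAt (fun x => φ x * tailInt φ x * (0.466 * Jt x - 0.33))
      ((deriv φ x * tailInt φ x - φ x ^ 2 * Ht x) * (0.466 * Jt x - 0.33)
        + φ x * tailInt φ x * (0.466 * (2 - Ht x ^ 2))) x :=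
    (hφ.hasDerivAt_mul_tailInt x).mul (((hasDerivAt_Jt x).const_mul 0.466).sub_const 0.33)
  have hT (x : ℝ) (hx : 1.05 ≤ x) : 0 ≤ 0.466 * Jt x - 0.33 := by
    have := Jt_ge hx
    norm_num at this ⊢
    linarith
  have := intervalIntegral.sub_le_integral_of_hasDeriv_right_of_le
    (g := fun x => φ x * tailInt φ x * (0.466 * Jt x - 0.33))
    (φ := fun x => φ x * tailInt φ x * Kt x) hX
    (fun x _ => (hd x).continuousAt.continuousWithinAt)
    (fun x _ => (hd x).hasDerivWithinAt)
    (((hφ.continuous.mul hφ.continuous_tailInt).mul continuous_Kt).continuousOn.integrableOn_Icc)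
    (fun x hx => by
      have hx1 := hx.1.le
      have h0 : 0 ≤ x := le_trans (by norm_num) hx1
      have hP := hφ.tailInt_nonneg h0
      have hH := Ht_nonneg h0
      have hφ0 := (hφ.pos x).le
      have h1 : deriv φ x * tailInt φ x ≤ -0.808 * φ x * tailInt φ x :=
        mul_le_mul_of_nonneg_right (hφ.deriv_le hx1) hP
      have h2 : φ x * Ht x * (0.808 * tailInt φ x) ≤ φ x * Ht x * φ x :=
        mul_le_mul_of_nonneg_left (hφ.tailInt_le hx1) (by positivity)
      have h3 : (deriv φ x * tailInt φ x - φ x ^ 2 * Ht x) * (0.466 * Jt x - 0.33) ≤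
          (φ x * tailInt φ x * (-0.808 * (1 + Ht x))) * (0.466 * Jt x - 0.33) :=
        mul_le_mul_of_nonneg_right (by linarith) (hT x hx1)
      have h4 : -0.808 * (1 + Ht x) * (0.466 * Jt x - 0.33) + 0.466 * (2 - Ht x ^ 2) ≤ Kt x := by
        have hJ := Jt_ge hx1
        have hH1 := Ht_lt_one x
        have h5 : 0 ≤ (0.808 * 0.466 * (1 + Ht x) - 3 / 4 * Ht x) * (Jt x - 1.8) :=
          mul_nonneg (by norm_num; linarith) (by linarith)
        unfold Kt
        norm_num at h5 ⊢
        nlinarith [sq_nonneg (Ht x - 1)]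
      have h5 := mul_le_mul_of_nonneg_left h4 (mul_nonneg hφ0 hP)
      linarith)
  have hend : 0 ≤ φ X * tailInt φ X * (0.466 * Jt X - 0.33) :=
    mul_nonneg (mul_nonneg (hφ.pos X).le (hφ.tailInt_nonneg (le_trans (by norm_num) hX))) (hT X hX)
  linarith

/-- The sign condition that replaces `⟨L̃⁻¹ φ, φ⟩ ≤ 0`. -/
lemma integral_mul_tailInt_mul_Kt_nonneg (hφ : IsGroundState φ μ) {X : ℝ} (hX : 1.05 ≤ X) :
    0 ≤ ∫ x in (0 : ℝ)..X, φ x * tailInt φ x * Kt x := by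
  have hc : Continuous fun x => φ x * tailInt φ x * Kt x :=
    (hφ.continuous.mul hφ.continuous_tailInt).mul continuous_Kt
  rw [← intervalIntegral.integral_add_adjacent_intervals (b := 1.05)
    (hc.intervalIntegrable _ _) (hc.intervalIntegrable _ _)]
  have h1 := hφ.le_integral_initial
  have h2 := hφ.le_integral_tail hX
  have h3 : 0.466 * Jt 1.05 - 0.33 ≤ (1.05 - 3 / 8 * 1.05 ^ 3 : ℝ) := by
    have := Jt_split_le
    norm_num at this ⊢
    linarith
  have h4 := mul_le_mul_of_nonneg_left h3
    (mul_nonneg (hφ.pos 1.05).le (hφ.tailInt_nonneg (by norm_num : (0 : ℝ) ≤ 1.05)))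
  linarith

end IsGroundState

/-- `u` is locally absolutely continuous with derivative `g ∈ L²`, and `Q̃ u ∈ L²`. -/
structure IsAdmissible (u g : ℝ → ℝ) : Prop where
  intervalIntegrable : ∀ a b, IntervalIntegrable g volume a b
  sub_eq_integral : ∀ a b, u b - u a = ∫ t in a..b, g t
  integrable_sq : Integrable fun x => g x ^ 2
  integrable_Qt_mul_sq : Integrable fun x => (Qt x * u x) ^ 2

lemma sq_integral_le {k : ℝ → ℝ} {b : ℝ} (hb : 0 ≤ b) (hk : IntervalIntegrable k volume 0 b)
    (hk2 : IntervalIntegrable (fun x => k x ^ 2) volume 0 b) :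
    (∫ x in (0 : ℝ)..b, k x) ^ 2 ≤ b * ∫ x in (0 : ℝ)..b, k x ^ 2 := by
  rcases hb.eq_or_lt with rfl | hb'
  · simp
  set w := ∫ x in (0 : ℝ)..b, k x with hw
  have h1 : 0 ≤ ∫ x in (0 : ℝ)..b, (b * k x - w) ^ 2 :=
    intervalIntegral.integral_nonneg hb fun x _ => sq_nonneg _
  have h2 : ∫ x in (0 : ℝ)..b, (b * k x - w) ^ 2 =
      b ^ 2 * (∫ x in (0 : ℝ)..b, k x ^ 2) - 2 * b * w * w + b * w ^ 2 := by
    have h3 (x : ℝ) : (b * k x - w) ^ 2 = b ^ 2 * k x ^ 2 - 2 * b * w * k x + w ^ 2 := by ring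
    simp_rw [h3]
    rw [intervalIntegral.integral_add ((hk2.const_mul _).sub (hk.const_mul _)) (by simp),
      intervalIntegral.integral_sub (hk2.const_mul _) (hk.const_mul _),
      intervalIntegral.integral_const_mul, intervalIntegral.integral_const_mul, ← hw]
    simp
  rw [h2] at h1
  have h4 : 0 ≤ b * (b * (∫ x in (0 : ℝ)..b, k x ^ 2) - w ^ 2) := by linarith
  have := nonneg_of_mul_nonneg_right h4 hb'
  linarith

namespace IsAdmissible

variable {u g : ℝ → ℝ}

lemma eq_add_integral (h : IsAdmissible u g) : u = fun x => u 0 + ∫ t in (0 : ℝ)..x, g t := by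
  ext x
  linarith [h.sub_eq_integral 0 x]

lemma continuous (h : IsAdmissible u g) : Continuous u := by
  rw [h.eq_add_integral]
  exact (intervalIntegral.continuous_primitive h.intervalIntegrable 0).const_add _

lemma absolutelyContinuousOnInterval (h : IsAdmissible u g) (a b : ℝ) :
    AbsolutelyContinuousOnInterval u a b := by
  have hu : u = fun x => u a + ∫ t in a..x, g t := by
    ext x
    linarith [h.sub_eq_integral a x]
  rw [hu]
  have hc : AbsolutelyContinuousOnInterval (fun _ => u a) a b :=
    ContDiffOn.absolutelyContinuousOnInterval contDiffOn_const
  exact hc.fun_add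
    ((h.intervalIntegrable a b).absolutelyContinuousOnInterval_intervalIntegral
      Set.left_mem_uIcc)

lemma ae_hasDerivAt (h : IsAdmissible u g) (a b : ℝ) :
    ∀ᵐ x, x ∈ Set.uIcc a b → HasDerivAt u (g x) x := by
  filter_upwards [(h.intervalIntegrable a b).ae_hasDerivAt_integral] with x hx hxm
  have hu : u = fun x => u a + ∫ t in a..x, g t := by
    ext x
    linarith [h.sub_eq_integral a x]
  rw [hu]
  exact (hx hxm a Set.left_mem_uIcc).const_add _

lemma exists_abs_le (h : IsAdmissible u g) : ∃ A ≥ 0, ∀ x, |u x| ≤ A * (1 + |x|) := by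
  set G := ∫ t, g t ^ 2 with hG
  have hG0 : 0 ≤ G := integral_nonneg fun t => sq_nonneg _
  refine ⟨|u 0| + 1 / 2 + G / 2, by positivity, fun x => ?_⟩
  have hi := h.integrable_sq.intervalIntegrable (a := 0) (b := x)
  have h1 : |∫ t in (0 : ℝ)..x, g t| ≤ |∫ t in (0 : ℝ)..x, (1 / 2 + 1 / 2 * g t ^ 2)| := by
    rw [← Real.norm_eq_abs]
    refine intervalIntegral.norm_integral_le_abs_of_norm_le (Eventually.of_forall fun t => ?_)
      (IntervalIntegrable.add intervalIntegrable_const (hi.const_mul _))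
    rw [Real.norm_eq_abs, ← sq_abs (g t)]
    nlinarith [sq_nonneg (|g t| - 1)]
  rw [intervalIntegral.integral_add (by simp) (hi.const_mul _),
    intervalIntegral.integral_const_mul, intervalIntegral.integral_const, sub_zero,
    smul_eq_mul] at h1
  have h2 : |∫ t in (0 : ℝ)..x, g t ^ 2| ≤ G := by
    rw [← Real.norm_eq_abs]
    refine intervalIntegral.norm_integral_le_integral_norm_uIoc.trans ?_
    simp only [Real.norm_eq_abs, abs_pow, sq_abs]
    exact setIntegral_le_integral h.integrable_sq (Eventually.of_forall fun t => sq_nonneg _)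
  have h3 := abs_add_le (x * (1 / 2)) (1 / 2 * ∫ t in (0 : ℝ)..x, g t ^ 2)
  rw [abs_mul, abs_mul, abs_of_pos (by norm_num : (0 : ℝ) < 1 / 2)] at h3
  have h4 := abs_add_le (u 0) (∫ t in (0 : ℝ)..x, g t)
  rw [← h.sub_eq_integral, add_sub_cancel, h.sub_eq_integral] at h4
  have h5 : 0 ≤ (|u 0| + G / 2) * |x| := by positivity
  linarith

lemma integrable_Qt_cube_mul_sq (h : IsAdmissible u g) :
    Integrable fun x => Qt x ^ 3 * u x ^ 2 := by
  refine (h.integrable_Qt_mul_sq.const_mul (3 / 2)).mono'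
    ((continuous_Qt.pow 3).mul (h.continuous.pow 2)).aestronglyMeasurable
    (Eventually.of_forall fun x => ?_)
  have := Qt_pos x
  rw [Real.norm_eq_abs, abs_of_nonneg (by positivity)]
  calc Qt x ^ 3 * u x ^ 2 = Qt x * (Qt x * u x) ^ 2 := by ring
    _ ≤ _ := by gcongr; exact Qt_le x

lemma comp_neg (h : IsAdmissible u g) : IsAdmissible (fun x => u (-x)) (fun x => -g (-x)) where
  intervalIntegrable a b := by
    have := (IntervalIntegrable.iff_comp_neg (f := g) (a := -a) (b := -b)).1
      (h.intervalIntegrable _ _)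
    rw [neg_neg, neg_neg] at this
    exact this.neg
  sub_eq_integral a b := by
    rw [intervalIntegral.integral_neg, intervalIntegral.integral_comp_neg, ← h.sub_eq_integral]
    ring
  integrable_sq := by simpa using h.integrable_sq.comp_neg
  integrable_Qt_mul_sq := by simpa [Qt_neg] using h.integrable_Qt_mul_sq.comp_neg

end IsAdmissible

/-- The energy density shifted by the Lagrange multiplier term `2aφ₀u`. -/
noncomputable def shiftedDensity (φ u g : ℝ → ℝ) (a x : ℝ) : ℝ :=
  g x ^ 2 - 2 / 3 * (Qt x ^ 3 * u x ^ 2) - 2 * a * (φ x * u x)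

/-- The boundary term produced by completing the square in `shiftedDensity`. -/
noncomputable def boundaryTerm (φ u : ℝ → ℝ) (a x : ℝ) : ℝ :=
  (3 / 4 * (1 - Ht x ^ 2) ^ 2 * u x ^ 2 + 2 * a * (tailInt φ x * u x)
    + 4 / 3 * a ^ 2 * (tailInt φ x ^ 2 * Kt x)) * (Ht x)⁻¹

lemma boundaryTerm_le (φ u : ℝ → ℝ) (a : ℝ) {x : ℝ} (hx : 0 < x) :
    boundaryTerm φ u a x ≤ 3 / 4 * (u x + 4 / 3 * a * tailInt φ x) ^ 2 * (Ht x)⁻¹ := by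
  have h1 : (1 - Ht x ^ 2) ^ 2 ≤ 1 := by
    have := Ht_sq_lt_one x
    nlinarith [sq_nonneg (Ht x)]
  have h2 := mul_le_mul_of_nonneg_right h1 (sq_nonneg (u x))
  have h3 := mul_le_mul_of_nonneg_left (Kt_le_one hx.le) (sq_nonneg (a * tailInt φ x))
  have := Ht_pos hx
  unfold boundaryTerm
  gcongr
  linarith

namespace IsGroundState

variable {φ u g : ℝ → ℝ} {μ : ℝ}

lemma hasDerivAt_boundaryTerm (hφ : IsGroundState φ μ) (a : ℝ) {x u' : ℝ} (hx : 0 < x)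
    (hu : HasDerivAt u u' x) :
    HasDerivAt (boundaryTerm φ u a)
      (u' ^ 2 - 2 / 3 * (Qt x ^ 3 * u x ^ 2) - 2 * a * (φ x * u x)
        - 8 / 3 * a ^ 2 * (φ x * tailInt φ x * Kt x)
        - (u' - (3 / 4 * (1 - Ht x ^ 2) ^ 2 * u x + a * tailInt φ x) / Ht x) ^ 2) x := by
  have hH := hasDerivAt_Ht x
  have hP := hφ.hasDerivAt_tailInt x
  have hne := (Ht_pos hx).ne'
  have hK : HasDerivAt Kt (-(3 / 4 * (3 / 4 * (1 - Ht x ^ 2) ^ 2) * Jt x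
      + 3 / 4 * Ht x * (2 - Ht x ^ 2))) x :=
    ((hH.const_mul (3 / 4)).mul (hasDerivAt_Jt x)).const_sub 1
  refine ((((((hH.pow 2).const_sub 1).pow 2).const_mul (3 / 4)).mul (hu.pow 2)).add
    ((hP.mul hu).const_mul (2 * a)) |>.add (((hP.pow 2).mul hK).const_mul (4 / 3 * a ^ 2))
    |>.mul (hH.inv hne)).congr_deriv ?_
  simp only [Pi.add_apply, Pi.mul_apply, Pi.pow_apply, Pi.inv_apply, Qt_eq, Kt]
  field_simp
  push_cast
  ring

lemma intervalIntegrable_shiftedDensity (hφ : IsGroundState φ μ) (h : IsAdmissible u g)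
    (a b c : ℝ) : IntervalIntegrable (shiftedDensity φ u g a) volume b c :=
  (h.integrable_sq.intervalIntegrable.sub
    (h.integrable_Qt_cube_mul_sq.intervalIntegrable.const_mul _)).sub
    (((hφ.continuous.mul h.continuous).intervalIntegrable _ _).const_mul _)

lemma continuous_mul_tailInt_mul_Kt (hφ : IsGroundState φ μ) :
    Continuous fun x => φ x * tailInt φ x * Kt x :=
  (hφ.continuous.mul hφ.continuous_tailInt).mul continuous_Kt

lemma absolutelyContinuousOnInterval_boundaryTerm (hφ : IsGroundState φ μ)
    (h : IsAdmissible u g) (a : ℝ) {b c : ℝ} (hb : 0 < b) (hbc : b ≤ c) :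
    AbsolutelyContinuousOnInterval (boundaryTerm φ u a) b c := by
  have hu := h.absolutelyContinuousOnInterval b c
  have hP := hφ.contDiff_tailInt
  have hH := contDiff_Ht
  have hK := contDiff_Kt
  have hp : AbsolutelyContinuousOnInterval (tailInt φ) b c :=
    hP.contDiffOn.absolutelyContinuousOnInterval
  have hc1 : AbsolutelyContinuousOnInterval (fun x => 3 / 4 * (1 - Ht x ^ 2) ^ 2) b c :=
    ContDiffOn.absolutelyContinuousOnInterval (by fun_prop)
  have hc2 : AbsolutelyContinuousOnInterval
      (fun x => 4 / 3 * a ^ 2 * (tailInt φ x ^ 2 * Kt x)) b c :=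
    ContDiffOn.absolutelyContinuousOnInterval (by fun_prop)
  have hinv : AbsolutelyContinuousOnInterval (fun x => (Ht x)⁻¹) b c := by
    refine ContDiffOn.absolutelyContinuousOnInterval (hH.contDiffOn.inv fun x hx => ?_)
    rw [Set.uIcc_of_le hbc] at hx
    exact (Ht_pos (hb.trans_le hx.1)).ne'
  have hu2 : AbsolutelyContinuousOnInterval (fun x => u x ^ 2) b c := by
    simpa only [sq] using hu.fun_mul hu
  exact (((hc1.fun_mul hu2).fun_add ((hp.fun_mul hu).const_mul (2 * a))).fun_add hc2).fun_mul hinv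

lemma boundaryTerm_sub_le (hφ : IsGroundState φ μ) (h : IsAdmissible u g) (a : ℝ) {b c : ℝ}
    (hb : 0 < b) (hbc : b ≤ c) :
    boundaryTerm φ u a c - boundaryTerm φ u a b ≤
      (∫ x in b..c, shiftedDensity φ u g a x)
        - 8 / 3 * a ^ 2 * ∫ x in b..c, φ x * tailInt φ x * Kt x := by
  have hac := hφ.absolutelyContinuousOnInterval_boundaryTerm h a hb hbc
  have h1 := hφ.intervalIntegrable_shiftedDensity h a b c
  have h2 := (hφ.continuous_mul_tailInt_mul_Kt.intervalIntegrable (μ := volume) b c).const_mul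
    (8 / 3 * a ^ 2)
  rw [← hac.integral_deriv_eq_sub, ← intervalIntegral.integral_const_mul,
    ← intervalIntegral.integral_sub h1 h2]
  refine intervalIntegral.integral_mono_ae_restrict hbc hac.intervalIntegrable_deriv
    (h1.sub h2) ?_
  rw [EventuallyLE, ae_restrict_iff' measurableSet_Icc]
  filter_upwards [h.ae_hasDerivAt b c] with x hx hxm
  rw [Set.uIcc_of_le hbc] at hx
  rw [(hφ.hasDerivAt_boundaryTerm a (hb.trans_le hxm.1) (hx hxm)).deriv]
  exact sub_le_self _ (sq_nonneg _)

lemma tendsto_boundary_bound (hφ : IsGroundState φ μ) (h : IsAdmissible u g) {a : ℝ}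
    (ha : u 0 + 4 / 3 * a * tailInt φ 0 = 0) :
    Tendsto (fun x => 3 / 4 * (u x + 4 / 3 * a * tailInt φ x) ^ 2 * (Ht x)⁻¹)
      (nhdsWithin 0 (Set.Ioi 0)) (nhds 0) := by
  set k : ℝ → ℝ := fun x => g x - 4 / 3 * a * (φ x * Ht x) with hk
  have hc : Continuous fun x => φ x * Ht x := hφ.continuous.mul continuous_Ht
  have hki (b c : ℝ) : IntervalIntegrable k volume b c :=
    (h.intervalIntegrable b c).sub ((hc.intervalIntegrable b c).const_mul _)
  have hki2 (b c : ℝ) : IntervalIntegrable (fun x => k x ^ 2) volume b c := by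
    have h1 : (fun x => k x ^ 2) = fun x => g x ^ 2 - 8 / 3 * a * (g x * (φ x * Ht x))
        + (4 / 3 * a * (φ x * Ht x)) ^ 2 := by
      ext x
      simp only [hk]
      ring
    rw [h1]
    exact (h.integrable_sq.intervalIntegrable.sub
      (((h.intervalIntegrable b c).mul_continuousOn hc.continuousOn).const_mul _)).add
      (((hc.const_mul _).pow 2).intervalIntegrable b c)
  have hw (x : ℝ) : u x + 4 / 3 * a * tailInt φ x = ∫ t in (0 : ℝ)..x, k t := by
    rw [hk, intervalIntegral.integral_sub (h.intervalIntegrable 0 x)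
      ((hc.intervalIntegrable 0 x).const_mul _), intervalIntegral.integral_const_mul,
      ← h.sub_eq_integral]
    simp only [tailInt, intervalIntegral.integral_same, sub_zero] at ha ⊢
    linarith
  have hlim1 : Tendsto (fun x => ∫ t in (0 : ℝ)..x, k t ^ 2) (nhdsWithin 0 (Set.Ioi 0))
      (nhds 0) := by
    have := (intervalIntegral.continuous_primitive hki2 0).tendsto 0
    rw [intervalIntegral.integral_same] at this
    exact this.mono_left nhdsWithin_le_nhds
  have hlim2 : Tendsto (fun x => (x⁻¹ * Ht x)⁻¹) (nhdsWithin 0 (Set.Ioi 0))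
      (nhds (3 / 4 : ℝ)⁻¹) := by
    have := (hasDerivAt_Ht 0).tendsto_slope_zero_right
    simp only [Ht_zero, zero_add, sub_zero, smul_eq_mul] at this
    norm_num at this
    have := this.inv₀ (by norm_num)
    norm_num at this ⊢
    exact this
  have hlim := (hlim1.mul hlim2).const_mul (3 / 4)
  rw [zero_mul, mul_zero] at hlim
  refine squeeze_zero' ?_ ?_ hlim
  · filter_upwards [self_mem_nhdsWithin] with x hx
    have := Ht_pos hx
    positivity
  · filter_upwards [self_mem_nhdsWithin] with x hx
    have hx0 : 0 < x := hx
    have hH := Ht_pos hx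
    have h1 := sq_integral_le hx0.le (hki 0 x) (hki2 0 x)
    rw [hw, mul_inv, inv_inv]
    calc 3 / 4 * (∫ t in (0 : ℝ)..x, k t) ^ 2 * (Ht x)⁻¹
        ≤ 3 / 4 * (x * ∫ t in (0 : ℝ)..x, k t ^ 2) * (Ht x)⁻¹ := by gcongr
      _ = _ := by ring

lemma boundaryTerm_le_integral (hφ : IsGroundState φ μ) (h : IsAdmissible u g) {a : ℝ}
    (ha : u 0 + 4 / 3 * a * tailInt φ 0 = 0) {X : ℝ} (hX : 1.05 ≤ X) :
    boundaryTerm φ u a X ≤ ∫ x in (0 : ℝ)..X, shiftedDensity φ u g a x := by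
  have hX0 : 0 < X := lt_of_lt_of_le (by norm_num) hX
  have hsplit {f : ℝ → ℝ} (hf : ∀ b c, IntervalIntegrable f volume b c) :
      Tendsto (fun ε => ∫ x in ε..X, f x) (nhdsWithin 0 (Set.Ioi 0))
        (nhds (∫ x in (0 : ℝ)..X, f x)) := by
    have h1 := ((intervalIntegral.continuous_primitive hf 0).tendsto 0).const_sub
      (∫ x in (0 : ℝ)..X, f x)
    rw [intervalIntegral.integral_same, sub_zero] at h1
    refine (h1.congr fun ε => ?_).mono_left nhdsWithin_le_nhds
    exact intervalIntegral.integral_interval_sub_left (hf _ _) (hf _ _)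
  have hlim := ((hsplit (hφ.intervalIntegrable_shiftedDensity h a)).sub
    ((hsplit (hφ.continuous_mul_tailInt_mul_Kt.intervalIntegrable (μ := volume))).const_mul
      (8 / 3 * a ^ 2))).add (hφ.tendsto_boundary_bound h ha)
  have hle : boundaryTerm φ u a X ≤ (∫ x in (0 : ℝ)..X, shiftedDensity φ u g a x)
      - 8 / 3 * a ^ 2 * (∫ x in (0 : ℝ)..X, φ x * tailInt φ x * Kt x) + 0 := by
    refine ge_of_tendsto hlim ?_
    filter_upwards [Ioc_mem_nhdsGT hX0] with ε hε
    have h1 := hφ.boundaryTerm_sub_le h a hε.1 hε.2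
    have h2 := boundaryTerm_le φ u a hε.1
    linarith
  have := hφ.integral_mul_tailInt_mul_Kt_nonneg hX
  have : 0 ≤ 8 / 3 * a ^ 2 * ∫ x in (0 : ℝ)..X, φ x * tailInt φ x * Kt x := by positivity
  linarith

lemma exists_le_boundaryTerm (hφ : IsGroundState φ μ) (h : IsAdmissible u g) (a : ℝ) :
    ∃ D, ∀ x, 1 ≤ x → -(D * (tailInt φ x * (1 + x))) ≤ boundaryTerm φ u a x := by
  obtain ⟨A, hA, hu⟩ := h.exists_abs_le
  refine ⟨(2 * |a| * A + 2 * a ^ 2 * tailInt φ 0) * (Ht 1)⁻¹, fun x hx => ?_⟩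
  have hx0 : 0 ≤ x := zero_le_one.trans hx
  have hP := hφ.tailInt_nonneg hx0
  have hP0 := hφ.tailInt_antitoneOn Set.self_mem_Ici hx0 hx0
  have hH1 := Ht_pos one_pos
  have hH : Ht 1 ≤ Ht x := strictMono_Ht.monotone hx
  have h1 : -(2 * |a| * A * (tailInt φ x * (1 + x))) ≤ 2 * a * (tailInt φ x * u x) := by
    have h2 := hu x
    rw [abs_of_nonneg hx0] at h2
    have h3 : |a * (tailInt φ x * u x)| ≤ |a| * (tailInt φ x * (A * (1 + x))) := by
      rw [abs_mul, abs_mul, abs_of_nonneg hP]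
      gcongr
    linarith [(abs_le.1 h3).1]
  have h4 : -(2 * a ^ 2 * tailInt φ 0 * (tailInt φ x * (1 + x))) ≤
      4 / 3 * a ^ 2 * (tailInt φ x ^ 2 * Kt x) := by
    have h5 : -(3 / 2 * (1 + x)) ≤ Kt x := by linarith [Kt_ge_linear hx0]
    have h6 := mul_le_mul_of_nonneg_left h5 (mul_nonneg (sq_nonneg a) (sq_nonneg (tailInt φ x)))
    have h7 := mul_le_mul_of_nonneg_left hP0
      (by positivity : 0 ≤ a ^ 2 * (tailInt φ x * (1 + x)))
    linarith
  have h8 : 0 ≤ 3 / 4 * (1 - Ht x ^ 2) ^ 2 * u x ^ 2 := by positivity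
  have hPM := hP.trans hP0
  have hD : 0 ≤ (2 * |a| * A + 2 * a ^ 2 * tailInt φ 0) * (tailInt φ x * (1 + x)) := by
    positivity
  unfold boundaryTerm
  calc -((2 * |a| * A + 2 * a ^ 2 * tailInt φ 0) * (Ht 1)⁻¹ * (tailInt φ x * (1 + x)))
      = -((2 * |a| * A + 2 * a ^ 2 * tailInt φ 0) * (tailInt φ x * (1 + x)) * (Ht 1)⁻¹) := by ring
    _ ≤ -((2 * |a| * A + 2 * a ^ 2 * tailInt φ 0) * (tailInt φ x * (1 + x)) * (Ht x)⁻¹) := by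
        gcongr
    _ = (-((2 * |a| * A + 2 * a ^ 2 * tailInt φ 0) * (tailInt φ x * (1 + x)))) * (Ht x)⁻¹ := by
        ring
    _ ≤ _ := by
        have := hH1.trans_le hH
        gcongr
        linarith

lemma integrable_mul (hφ : IsGroundState φ μ) (h : IsAdmissible u g) :
    Integrable fun x => φ x * u x := by
  obtain ⟨A, -, hu⟩ := h.exists_abs_le
  exact hφ.integrable_mul_of_linear_growth h.continuous.aestronglyMeasurable hu

/-- The constrained energy inequality on the half-line. -/
lemma energy_Ioi_ge (hφ : IsGroundState φ μ) (h : IsAdmissible u g) {a : ℝ}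
    (ha : u 0 + 4 / 3 * a * tailInt φ 0 = 0) :
    2 * a * (∫ x in Set.Ioi 0, φ x * u x) ≤
      (∫ x in Set.Ioi 0, g x ^ 2) - 2 / 3 * ∫ x in Set.Ioi 0, Qt x ^ 3 * u x ^ 2 := by
  have hi1 := h.integrable_sq.integrableOn (s := Set.Ioi 0)
  have hi2 := (h.integrable_Qt_cube_mul_sq.integrableOn (s := Set.Ioi 0)).const_mul (2 / 3)
  have hi3 := ((hφ.integrable_mul h).integrableOn (s := Set.Ioi 0)).const_mul (2 * a)
  obtain ⟨D, hD⟩ := hφ.exists_le_boundaryTerm h a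
  have hlim1 : Tendsto (fun x => -(D * (tailInt φ x * (1 + x)))) atTop (nhds 0) := by
    simpa using (hφ.tendsto_tailInt_mul_one_add.const_mul D).neg
  have hlim2 := intervalIntegral_tendsto_integral_Ioi (f := shiftedDensity φ u g a) 0
    ((hi1.sub hi2).sub hi3) tendsto_id
  have h0 : 0 ≤ ∫ x in Set.Ioi 0, shiftedDensity φ u g a x := by
    refine le_of_tendsto_of_tendsto hlim1 hlim2 ?_
    filter_upwards [eventually_ge_atTop 1.05] with x hx
    exact (hD x (le_trans (by norm_num) hx)).trans (hφ.boundaryTerm_le_integral h ha hx)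
  have h1 : ∫ x in Set.Ioi 0, shiftedDensity φ u g a x = (∫ x in Set.Ioi 0, g x ^ 2)
      - 2 / 3 * (∫ x in Set.Ioi 0, Qt x ^ 3 * u x ^ 2)
      - 2 * a * ∫ x in Set.Ioi 0, φ x * u x := by
    unfold shiftedDensity
    rw [integral_sub (by exact hi1.sub hi2) hi3, integral_sub hi1 hi2, integral_const_mul,
      integral_const_mul]
  linarith

end IsGroundState

lemma integral_Ioi_comp_neg_add {f : ℝ → ℝ} (hf : Integrable f) :
    (∫ x in Set.Ioi 0, f x) + (∫ x in Set.Ioi 0, f (-x)) = ∫ x, f x := by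
  rw [integral_comp_neg_Ioi, neg_zero, add_comm]
  exact intervalIntegral.integral_Iic_add_Ioi hf.integrableOn hf.integrableOn

lemma IsGroundState.energy_nonneg {φ u g : ℝ → ℝ} {μ : ℝ} (hφ : IsGroundState φ μ)
    (h : IsAdmissible u g) (horth : ∫ x, φ x * u x = 0) :
    0 ≤ (∫ x, g x ^ 2) - 2 / 3 * ∫ x, Qt x ^ 3 * u x ^ 2 := by
  have hM := hφ.tailInt_zero_pos.ne'
  obtain ⟨a, ha⟩ : ∃ a, u 0 + 4 / 3 * a * tailInt φ 0 = 0 :=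
    ⟨-(3 / 4 * u 0 / tailInt φ 0), by field_simp; ring⟩
  have h1 := hφ.energy_Ioi_ge h ha
  have h2 := hφ.energy_Ioi_ge h.comp_neg (a := a) (by simpa using ha)
  rw [← integral_Ioi_comp_neg_add (hφ.integrable_mul h)] at horth
  rw [← integral_Ioi_comp_neg_add h.integrable_sq,
    ← integral_Ioi_comp_neg_add h.integrable_Qt_cube_mul_sq]
  simp only [hφ.even, Qt_neg, neg_sq] at horth h2 ⊢
  have h3 : 2 * a * ((∫ x in Set.Ioi 0, φ x * u x) + ∫ x in Set.Ioi 0, φ x * u (-x)) = 0 := by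
    rw [horth, mul_zero]
  linarith

lemma ae_eq_const_of_not_locallyIntegrable {u g : ℝ → ℝ}
    (hac : ∀ a b : ℝ, u b - u a = ∫ t in a..b, g t) (h : ¬LocallyIntegrable g) :
    ∃ c, ∀ᵐ x, u x = c := by
  obtain ⟨p, hp⟩ := not_forall.1 h
  have hA {a b : ℝ} (ha : a < p) (hb : p < b) : u a = u b := by
    have h1 := hac a b
    rw [intervalIntegral.integral_undef] at h1
    · linarith
    · intro hi
      rw [intervalIntegrable_iff_integrableOn_Icc_of_le (ha.trans hb).le] at hi
      exact hp ⟨_, Icc_mem_nhds ha hb, hi⟩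
  refine ⟨u (p + 1), ?_⟩
  filter_upwards [compl_mem_ae_iff.2 (measure_singleton p)] with x hx
  rcases lt_or_gt_of_ne hx with h1 | h1
  · exact hA h1 (by linarith)
  · exact (hA (a := p - 1) (by linarith) h1).symm.trans (hA (by linarith) (by linarith))

/-- Non-negativity of the quadratic form of `L̃u = −u'' − (2/3)Q̃³u`
for functions in `H₀` orthogonal to the ground state `φ₀`.  Membership of `u`
in `H₀` is encoded by a locally absolutely continuous `u` with derivative `g`
satisfying `g ∈ L²` and `Q̃·u ∈ L²`. -/
theorem tilde_L_nonneg_orthogonal (φ₀ : ℝ → ℝ) (μ₀ : ℝ)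
    (hC2 : ContDiff ℝ 2 φ₀) (hpos : ∀ x : ℝ, 0 < φ₀ x)
    (heven : ∀ x : ℝ, φ₀ (-x) = φ₀ x)
    (hL2 : Integrable (fun x => (φ₀ x)^2))
    (hμ1 : (0.808:ℝ) ≤ μ₀) (hμ2 : μ₀ ≤ (0.883:ℝ))
    (heq : ∀ x : ℝ, -(deriv (deriv φ₀) x) + Vpot x * φ₀ x = -μ₀^2 * φ₀ x)
    (hdecay : ∃ C > (0:ℝ), ∀ x : ℝ,
      |φ₀ x| + |deriv φ₀ x| ≤ C * Real.exp (-(Real.sqrt 2 / 2) * μ₀ * |x|))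
    (u g : ℝ → ℝ)
    (hac : ∀ a b : ℝ, u b - u a = ∫ t in a..b, g t)
    (hg : Integrable (fun x => (g x)^2))
    (hQu : Integrable (fun x => (Qt x * u x)^2))
    (horth : (∫ x, φ₀ x * u x) = 0) :
    0 ≤ (∫ x, (g x)^2) - (2/3) * ∫ x, (Qt x)^3 * (u x)^2 := by
  obtain ⟨C, hC, hdec⟩ := hdecay
  have hφ : IsGroundState φ₀ μ₀ :=
    { contDiff := hC2
      pos := hpos
      even := heven
      le_mu := hμ1
      deriv_deriv := fun x => by linarith [heq x]
      decay := ⟨C, hC, Real.sqrt 2 / 2 * μ₀, by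
        have : 0 < μ₀ := lt_of_lt_of_le (by norm_num) hμ1
        positivity, fun x => by simpa only [neg_mul] using hdec x⟩ }
  by_cases hloc : LocallyIntegrable g
  · exact hφ.energy_nonneg
      ⟨fun a b => intervalIntegrable_iff.2
        ((hloc.integrableOn_isCompact isCompact_uIcc).mono_set Set.uIoc_subset_uIcc),
        hac, hg, hQu⟩ horth
  · obtain ⟨c, hc⟩ := ae_eq_const_of_not_locallyIntegrable hac hloc
    have hint : Integrable φ₀ := by
      simpa using hφ.integrable_mul_of_linear_growth (v := fun _ => 1) (A := 1)
        aestronglyMeasurable_const (fun x => by simp)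
    have hφpos : 0 < ∫ x, φ₀ x := by
      rw [integral_pos_iff_support_of_nonneg (fun x => (hpos x).le) hint]
      rw [show Function.support φ₀ = Set.univ from
        Set.eq_univ_of_forall fun x => (hpos x).ne']
      simp
    have h1 : ∫ x, φ₀ x * u x = (∫ x, φ₀ x) * c := by
      rw [← integral_mul_const]
      exact integral_congr_ae (hc.mono fun x hx => by simp only [hx])
    have hc0 : c = 0 := by
      rw [horth] at h1
      exact (mul_eq_zero.1 h1.symm).resolve_left hφpos.ne'
    have h2 : ∫ x, Qt x ^ 3 * u x ^ 2 = 0 :=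
      integral_eq_zero_of_ae (hc.mono fun x hx => by simp [hx, hc0])
    rw [h2, mul_zero, sub_zero]
    exact integral_nonneg fun x => sq_nonneg _
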